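/- Let K be a field, S = K[x,y,z,w] the polynomial ring in four variables over K, and I ⊆ S a monomial ideal. If S/I is sequentially Cohen–Macaulay, then I is a Stanley ideal, i.e. S/I admits a Stanley decomposition S/I = ⊕_{i=1}^r u_i K[Z_i] with |Z_i| ≥ depth(S/I) for all i. -/

import Mathlib

open MvPolynomial

/-- The depth of an `S`-module `M` with respect to an ideal `m`: the supremum of
lengths of `M`-regular sequences consisting of elements of `m`. -/
noncomputable def mDepth (S : Type*) [CommRing S] (m : Ideal S)
    (M : Type*) [AddCommGroup M] [Module S M] : ℕ∞ :=
  sSup {n : ℕ∞ | ∃ rs : List S, (rs.length : ℕ∞) = n ∧ (∀ r ∈ rs, r ∈ m) ∧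
    RingTheory.Sequence.IsRegular M rs}

/-- `M` is a Cohen–Macaulay `S`-module (w.r.t. the ideal `m`) if its depth with
respect to `m` equals its Krull dimension, i.e. the Krull dimension of `S ⧸ ann M`. -/
def IsCM (S : Type*) [CommRing S] (m : Ideal S)
    (M : Type*) [AddCommGroup M] [Module S M] : Prop :=
  (mDepth S m M : WithBot ℕ∞) = ringKrullDim (S ⧸ Module.annihilator S M)

/-- `F` is a prime filtration `I = F₀ ⊆ F₁ ⊆ ... ⊆ F_r = S` with
`F_i/F_{i-1} ≅ S/P_i` for prime ideals `P_i`. -/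
def IsPrimeFiltration {S : Type*} [CommRing S] (I : Ideal S) (r : ℕ)
    (F : Fin (r + 1) → Ideal S) (P : Fin r → Ideal S) : Prop :=
  F 0 = I ∧ F (Fin.last r) = ⊤ ∧ (∀ i : Fin r, F i.castSucc ≤ F i.succ) ∧
  ∀ i : Fin r, (P i).IsPrime ∧
    Nonempty ((↥(Submodule.map (F i.castSucc).mkQ (F i.succ))) ≃ₗ[S] (S ⧸ P i))

/-- `S/I` is clean: it has a prime filtration all of whose primes are minimal
primes of `I`. -/
def IsClean {S : Type*} [CommRing S] (I : Ideal S) : Prop :=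
  ∃ (r : ℕ) (F : Fin (r + 1) → Ideal S) (P : Fin r → Ideal S),
    IsPrimeFiltration I r F P ∧ ∀ i, P i ∈ I.minimalPrimes

/-- `S/I` is pretty clean: it has a prime filtration such that `i ≤ j` and
`P i ⊆ P j` imply `P i = P j`. -/
def IsPrettyClean {S : Type*} [CommRing S] (I : Ideal S) : Prop :=
  ∃ (r : ℕ) (F : Fin (r + 1) → Ideal S) (P : Fin r → Ideal S),
    IsPrimeFiltration I r F P ∧ ∀ i j : Fin r, i ≤ j → P i ≤ P j → P i = P j

/-- A (finitely generated) `S`-module `M` is clean: it has a filtration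
`0 = M₀ ⊆ M₁ ⊆ ... ⊆ M_r = M` with `M_i/M_{i-1} ≅ S/P_i` where each `P_i` is a
minimal prime of the support of `M`, i.e. a minimal prime over `ann M`. -/
def IsCleanModule (S : Type*) [CommRing S] (M : Type*) [AddCommGroup M] [Module S M] : Prop :=
  ∃ (r : ℕ) (F : Fin (r + 1) → Submodule S M) (P : Fin r → Ideal S),
    F 0 = ⊥ ∧ F (Fin.last r) = ⊤ ∧ (∀ i : Fin r, F i.castSucc ≤ F i.succ) ∧
    (∀ i : Fin r, (P i).IsPrime ∧
      Nonempty ((↥(F i.succ) ⧸ (Submodule.comap (F i.succ).subtype (F i.castSucc)))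
        ≃ₗ[S] (S ⧸ P i))) ∧
    ∀ i, P i ∈ (Module.annihilator S M).minimalPrimes

/-- An ideal of a polynomial ring is a monomial ideal if it is generated by monomials. -/
def IsMonomialIdeal {σ K : Type*} [CommSemiring K] (I : Ideal (MvPolynomial σ K)) : Prop :=
  ∃ G : Set (MvPolynomial σ K),
    (∀ g ∈ G, ∃ e : σ →₀ ℕ, g = MvPolynomial.monomial e 1) ∧ I = Ideal.span G

/-- The height of an ideal: the infimum of the heights of the primes containing it. -/
noncomputable def idealHeight {S : Type*} [CommRing S] (I : Ideal S) : ℕ∞ :=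
  sInf {n : ℕ∞ | ∃ q : PrimeSpectrum S, I ≤ q.asIdeal ∧ Order.height q = n}

section RegularSequence

open RingTheory.Sequence Pointwise

/-- Modulo a regular element of `m`, an associated prime contained in `m` is strictly contained in
another associated prime contained in `m`. -/
theorem exists_colon_gt_of_isSMulRegular {R M : Type*} [CommRing R] [IsNoetherianRing R]
    [AddCommGroup M] [Module R M] [Module.Finite R M] {m p : Ideal R} [m.IsPrime] [p.IsPrime]
    (hpm : p ≤ m) {x : M} (hx : p = (⊥ : Submodule R M).colon {x}) {f : R} (hf : f ∈ m)
    (hreg : IsSMulRegular M f) :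
    ∃ (q : Ideal R) (y : QuotSMulTop f M), q.IsPrime ∧ q ≤ m ∧ p < q ∧
      q = (⊥ : Submodule R (QuotSMulTop f M)).colon {y} := by
  have hann : ∀ r, r ∈ p ↔ r • x = 0 := fun r => by
    rw [hx, Submodule.mem_colon_singleton, Submodule.mem_bot]
  have hfp : f ∉ p := fun h => by
    have hx0 : x = 0 := hreg (by simpa using (hann f).1 h)
    exact Ideal.IsPrime.ne_top ‹p.IsPrime› ((Ideal.eq_top_iff_one _).2 ((hann 1).2 (by simp [hx0])))
  let N : Submodule R M :=
    { carrier := {z | ∀ r ∈ p, r • z = 0}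
      add_mem' := fun {a b} ha hb r hr => by rw [smul_add, ha r hr, hb r hr, add_zero]
      zero_mem' := fun r _ => smul_zero r
      smul_mem' := fun c z hz r hr => by rw [smul_comm, hz r hr, smul_zero] }
  have hxN : x ∈ N := fun r hr => (hann r).1 hr
  let π : M →ₗ[R] QuotSMulTop f M := Submodule.mkQ _
  have hπ : ∀ z, π z = 0 ↔ ∃ w, f • w = z := fun z => by
    simp only [π, Submodule.mkQ_apply, Submodule.Quotient.mk_eq_zero,
      Submodule.mem_smul_pointwise_iff_exists, Submodule.mem_top, true_and]
  obtain ⟨z, hzN, hz⟩ : ∃ z ∈ N, ∀ s, s • π z = 0 → s ∈ m := by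
    by_contra! hcon
    obtain ⟨G, hG⟩ := IsNoetherian.noetherian N
    choose! s hs using hcon
    let t := ∏ g ∈ G, s g
    have ht : t ∉ m := fun h => by
      obtain ⟨g, hg, h⟩ := Ideal.IsPrime.prod_mem_iff.1 h
      exact (hs g (hG ▸ Submodule.subset_span hg)).2 h
    have hle : ∀ z ∈ N, ∃ w ∈ N, f • w = t • z := by
      intro z hz
      rw [← hG] at hz
      induction hz using Submodule.span_induction with
      | mem g hg =>
        have hgN : g ∈ N := hG ▸ Submodule.subset_span hg
        have h0 : π (t • g) = 0 := by
          obtain ⟨c, hc⟩ := Finset.dvd_prod_of_mem s hg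
          rw [map_smul, show t = c * s g by rw [mul_comm]; exact hc, mul_smul, (hs g hgN).1,
            smul_zero]
        obtain ⟨w, hw⟩ := (hπ _).1 h0
        refine ⟨w, fun r hr => hreg ?_, hw⟩
        change f • r • w = f • 0
        rw [smul_comm, hw, smul_comm, hgN r hr, smul_zero, smul_zero]
      | zero => exact ⟨0, N.zero_mem, by simp⟩
      | add a b _ _ ha hb =>
        obtain ⟨u, hu, hu'⟩ := ha
        obtain ⟨v, hv, hv'⟩ := hb
        exact ⟨u + v, N.add_mem hu hv, by rw [smul_add, smul_add, hu', hv']⟩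
      | smul c a _ ha =>
        obtain ⟨u, hu, hu'⟩ := ha
        exact ⟨c • u, N.smul_mem c hu, by rw [smul_comm, hu', smul_comm]⟩
    obtain ⟨P, hP, -, hPc, hP0⟩ :=
      LinearMap.exists_monic_and_natDegree_eq_and_coeff_mem_pow_and_aeval_eq_zero
        R (algebraMap R (Module.End R N) t) (Ideal.span {f}) (by
          rintro _ ⟨⟨z, hz⟩, rfl⟩
          obtain ⟨w, hw, hwz⟩ := hle z hz
          rw [show algebraMap R (Module.End R N) t ⟨z, hz⟩ = f • (⟨w, hw⟩ : N) from
            Subtype.ext hwz.symm]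
          exact Submodule.smul_mem_smul (Ideal.mem_span_singleton_self f) trivial)
    rw [Polynomial.aeval_algebraMap_apply] at hP0
    have h1 : P.eval t ∈ m := hpm ((hann _).2 (by
      have := congrArg Subtype.val (LinearMap.congr_fun hP0 ⟨x, hxN⟩)
      simpa using this))
    rw [Polynomial.eval_eq_sum_range, Finset.sum_range_succ, hP.coeff_natDegree, one_mul] at h1
    have h2 : ∑ k ∈ Finset.range P.natDegree, P.coeff k * t ^ k ∈ m := by
      refine Ideal.sum_mem _ fun k hk => Ideal.mul_mem_right _ _ ?_
      have h3 : P.coeff k ∈ Ideal.span {f} :=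
        Ideal.pow_le_self (by have := Finset.mem_range.1 hk; omega) (hPc k)
      exact (Ideal.span_singleton_le_iff_mem _).2 hf h3
    exact ht (Ideal.IsPrime.mem_of_pow_mem ‹_› _ ((Ideal.add_mem_iff_right _ h2).1 h1))
  have hle : (⊥ : Submodule R (QuotSMulTop f M)).colon {π z} ≤ m := fun s hs =>
    hz s (by simpa [Submodule.mem_colon_singleton] using hs)
  obtain ⟨q, hq, hqm⟩ := Ideal.exists_minimalPrimes_le hle
  obtain ⟨y, hy⟩ := Submodule.exists_eq_colon_of_mem_minimalPrimes hq
  have hfq : f ∈ q := hq.1.2 (by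
    rw [Submodule.mem_colon_singleton, Submodule.mem_bot, ← map_smul]
    exact (hπ _).2 ⟨z, rfl⟩)
  have hpq : p ≤ q := fun r hr => hq.1.2 (by
    rw [Submodule.mem_colon_singleton, Submodule.mem_bot, ← map_smul, hzN r hr, map_zero])
  exact ⟨q, y, hq.1.1, hqm, lt_of_le_of_ne hpq fun h => hfp (h ▸ hfq), hy⟩

/-- A weakly regular sequence in `m` has length at most `ht m - ht p` for every associated prime
`p ≤ m` of the module. -/
theorem length_add_height_le_of_isWeaklyRegular {R : Type*} [CommRing R] [IsNoetherianRing R]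
    {m : Ideal R} [m.IsPrime] (rs : List R) (hrs : ∀ r ∈ rs, r ∈ m) {M : Type*}
    [AddCommGroup M] [Module R M] [Module.Finite R M] (hreg : IsWeaklyRegular M rs)
    {p : Ideal R} [p.IsPrime] (hpm : p ≤ m) {x : M}
    (hx : p = (⊥ : Submodule R M).colon {x}) :
    (rs.length : ℕ∞) + p.height ≤ m.height := by
  induction rs generalizing M p with
  | nil => simpa using Ideal.height_mono hpm
  | cons f rs ih =>
    rw [isWeaklyRegular_cons_iff] at hreg
    obtain ⟨q, y, _, hqm, hpq, hy⟩ :=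
      exists_colon_gt_of_isSMulRegular hpm hx (hrs f List.mem_cons_self) hreg.1
    calc ((f :: rs).length : ℕ∞) + p.height = rs.length + (p.height + 1) := by
          rw [List.length_cons, Nat.cast_add, Nat.cast_one, add_assoc, add_comm 1]
      _ ≤ rs.length + q.height := by
          gcongr
          exact Ideal.height_add_one_le_of_lt_of_isPrime hpq
      _ ≤ m.height := ih (fun r hr => hrs r (List.mem_cons_of_mem _ hr)) hreg.2 hqm hy

/-- If `f, g` is a regular sequence in the radical of `P + P'`, and `P P'` kills `x`, then the pair
`(x, 0)` of sections on `D(P)` and `D(P')` extends to an element of the module. -/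
theorem exists_extension_of_isSMulRegular {R M : Type*} [CommRing R] [AddCommGroup M] [Module R M]
    {f g : R} (hf : IsSMulRegular M f) (hg : IsSMulRegular (QuotSMulTop f M) g)
    {P P' : Ideal R} (hfP : f ∈ (P ⊔ P').radical) (hgP : g ∈ (P ⊔ P').radical) {x : M}
    (hPP : ∀ a ∈ P, ∀ b ∈ P', (a * b) • x = 0) :
    ∃ s : M, (∀ a ∈ P, a • s = a • x) ∧ ∀ b ∈ P', b • s = 0 := by
  obtain ⟨N, hN⟩ := hfP
  obtain ⟨L, hL⟩ := hgP
  obtain ⟨p, hp, p', hp', hpp⟩ := Submodule.mem_sup.1 hN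
  obtain ⟨q, hq, q', hq', hqq⟩ := Submodule.mem_sup.1 hL
  have hquot : ∀ w w' : M, g ^ L • w = f • w' → ∃ v, w = f • v := by
    intro w w' h
    have h0 : (Submodule.Quotient.mk w : QuotSMulTop f M) = 0 := hg.pow L (by
      change g ^ L • _ = g ^ L • _
      rw [smul_zero, ← Submodule.Quotient.mk_smul, h, Submodule.Quotient.mk_eq_zero]
      exact Submodule.smul_mem_pointwise_smul _ _ _ trivial)
    obtain ⟨v, -, hv⟩ := (Submodule.mem_smul_pointwise_iff_exists _ _ _).1
      ((Submodule.Quotient.mk_eq_zero _).1 h0)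
    exact ⟨v, hv.symm⟩
  have hpow : ∀ n : ℕ, ∀ w w' : M, g ^ L • w = f ^ n • w' → ∃ v, w = f ^ n • v := by
    intro n
    induction n with
    | zero => exact fun w _ _ => ⟨w, by simp⟩
    | succ n ih =>
      intro w w' h
      obtain ⟨v, rfl⟩ := hquot w (f ^ n • w') (by rw [h, pow_succ', mul_smul])
      obtain ⟨u, rfl⟩ := ih v w' (hf (by
        change f • g ^ L • v = f • f ^ n • w'
        rw [smul_comm, h, pow_succ', mul_smul]))
      exact ⟨u, by rw [pow_succ', mul_smul]⟩
  obtain ⟨s, hs⟩ := hpow N (p • x) (q • x) (by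
    rw [← hpp, ← hqq, smul_smul, smul_smul, add_mul, add_mul, add_smul, add_smul,
      mul_comm q' p, hPP p hp q' hq', mul_comm p' q, hPP q hq p' hp', mul_comm])
  refine ⟨s, fun a ha => hf.pow N ?_, fun b hb => hf.pow N ?_⟩
  · change f ^ N • a • s = f ^ N • a • x
    rw [smul_comm, ← hs, ← hpp, smul_smul, smul_smul, add_mul, add_smul, mul_comm p' a,
      hPP a ha p' hp', add_zero, mul_comm]
  · change f ^ N • b • s = f ^ N • 0
    rw [smul_comm, ← hs, smul_smul, mul_comm, hPP p hp b hb, smul_zero]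

end RegularSequence

namespace MvPolynomial

variable {σ K : Type*} [Field K]

theorem isPrime_span_X_image (s : Set σ) :
    (Ideal.span (X '' s : Set (MvPolynomial σ K))).IsPrime := by
  have h : Ideal.span (X '' s : Set (MvPolynomial σ K)) =
      RingHom.ker (killCompl (R := K) (Subtype.val_injective : Function.Injective
        (Subtype.val : {i // i ∉ s} → σ))).toRingHom := by
    ext f
    rw [mem_ideal_span_X_image, RingHom.mem_ker]
    constructor
    · intro h
      ext v
      change coeff v (killCompl _ f) = _
      rw [coeff_killCompl, coeff_zero]
      by_contra hv
      obtain ⟨i, hi, hvi⟩ := h _ (mem_support_iff.2 hv)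
      exact hvi (Finsupp.mapDomain_of_notMem_range _ _ (by simpa using hi))
    · intro h v hv
      by_contra! hcon
      have hsub : (v.support : Set σ) ⊆ Set.range (Subtype.val : {i // i ∉ s} → σ) := by
        intro i hi
        by_contra hi'
        exact (Finsupp.mem_support_iff.1 hi) (hcon i (by simpa using hi'))
      have h0 : coeff (v.comapDomain _ Subtype.val_injective.injOn)
          (killCompl (R := K) (Subtype.val_injective : Function.Injective
            (Subtype.val : {i // i ∉ s} → σ)) f) = 0 := by
        rw [show killCompl (R := K) (Subtype.val_injective : Function.Injective
            (Subtype.val : {i // i ∉ s} → σ)) f = 0 from h, coeff_zero]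
      rw [coeff_killCompl, Finsupp.mapDomain_comapDomain _ Subtype.val_injective _ hsub] at h0
      exact mem_support_iff.1 hv h0
  rw [h]
  exact RingHom.ker_isPrime _

theorem card_le_height_span_X_image (s : Finset σ) :
    (s.card : ℕ∞) ≤ (Ideal.span (X '' (s : Set σ) : Set (MvPolynomial σ K))).height := by
  classical
  induction s using Finset.induction_on with
  | empty => simp
  | insert i s hi ih =>
    have := isPrime_span_X_image (K := K) (s : Set σ)
    have := isPrime_span_X_image (K := K) ((insert i s : Finset σ) : Set σ)
    rw [Finset.card_insert_of_notMem hi, Nat.cast_add, Nat.cast_one]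
    refine (add_le_add_left ih 1).trans (Ideal.height_add_one_le_of_lt_of_isPrime ?_)
    refine lt_of_le_of_ne (Ideal.span_mono (Set.image_mono (by simp))) fun h => ?_
    have hX : (X i : MvPolynomial σ K) ∈ Ideal.span (X '' (s : Set σ)) :=
      h ▸ Ideal.subset_span ⟨i, by simp, rfl⟩
    rw [mem_ideal_span_X_image] at hX
    obtain ⟨j, hj, hj'⟩ := hX (Finsupp.single i 1) (by simp [support_X])
    rcases eq_or_ne i j with rfl | hij
    · exact hi hj
    · exact hj' (Finsupp.single_eq_of_ne' hij)

theorem height_span_X_image_le [Finite σ] (s : Finset σ) :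
    (Ideal.span (X '' (s : Set σ) : Set (MvPolynomial σ K))).height ≤ s.card := by
  have := isPrime_span_X_image (K := K) (s : Set σ)
  have h := Ideal.height_le_card_of_mem_minimalPrimes_span
    (p := Ideal.span (X '' (s : Set σ) : Set (MvPolynomial σ K))) (s.finite_toSet.image X)
    (by rw [Ideal.minimalPrimes_eq_subsingleton_self]; rfl)
  refine h.trans ?_
  have := Set.ncard_image_le (f := (X : σ → MvPolynomial σ K)) s.finite_toSet
  rw [Set.ncard_coe_finset] at this
  exact_mod_cast this

end MvPolynomial

namespace IsMonomialIdeal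

open MvPolynomial

variable {σ K : Type*} [Field K] {I : Ideal (MvPolynomial σ K)}

theorem mem_iff (hI : IsMonomialIdeal I) (f : MvPolynomial σ K) :
    f ∈ I ↔ ∀ v, coeff v f ≠ 0 → monomial v (1 : K) ∈ I := by
  classical
  obtain ⟨G, hG, rfl⟩ := hI
  have hGs : G = (fun s => monomial s (1 : K)) '' {e | monomial e (1 : K) ∈ G} := by
    ext g
    constructor
    · intro hg
      obtain ⟨e, rfl⟩ := hG g hg
      exact ⟨e, hg, rfl⟩
    · rintro ⟨e, he, rfl⟩
      exact he
  rw [hGs]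
  constructor
  · intro hf v hv
    rw [mem_ideal_span_monomial_image] at hf ⊢
    intro w hw
    rw [mem_support_iff, coeff_monomial] at hw
    obtain rfl : v = w := by
      by_contra h
      simp [h] at hw
    exact hf v (mem_support_iff.2 hv)
  · intro h
    rw [f.as_sum]
    refine Ideal.sum_mem _ fun v hv => ?_
    rw [show monomial v (coeff v f) = C (coeff v f) * monomial v 1 by simp [C_mul_monomial]]
    exact Ideal.mul_mem_left _ _ (h v (mem_support_iff.1 hv))

theorem mul_monomial_mem_iff (hI : IsMonomialIdeal I) (f : MvPolynomial σ K) (b : σ →₀ ℕ) :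
    f * monomial b 1 ∈ I ↔ ∀ v, coeff v f ≠ 0 → monomial (v + b) (1 : K) ∈ I := by
  rw [hI.mem_iff]
  constructor
  · intro h v hv
    exact h _ (by rwa [coeff_mul_monomial, mul_one])
  · intro h v hv
    rw [coeff_mul_monomial'] at hv
    split_ifs at hv with hb
    · rw [mul_one] at hv
      simpa [tsub_add_cancel_of_le hb] using h _ hv
    · exact absurd rfl hv

/-- The face `b + ℕ^F` of a monomial ideal `I` with `I : x^b` prime has dimension at least the
length of any weakly regular sequence on `S ⧸ I`. -/
theorem length_le_card [Fintype σ] [DecidableEq σ] (hI : IsMonomialIdeal I)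
    {rs : List (MvPolynomial σ K)}
    (hrs : ∀ r ∈ rs, r ∈ Ideal.span (X '' (Set.univ : Set σ) : Set (MvPolynomial σ K)))
    (hreg : RingTheory.Sequence.IsWeaklyRegular (MvPolynomial σ K ⧸ I) rs)
    {b : σ →₀ ℕ} {F : Finset σ}
    (hF : ∀ v : σ →₀ ℕ, (∀ i, v i ≠ 0 → i ∈ F) → monomial (v + b) (1 : K) ∉ I)
    (hF' : ∀ i ∉ F, monomial (Finsupp.single i 1 + b) (1 : K) ∈ I) :
    rs.length ≤ F.card := by
  have hcolon : Ideal.span (X '' ((Fᶜ : Finset σ) : Set σ) : Set (MvPolynomial σ K)) =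
      (⊥ : Submodule (MvPolynomial σ K) (MvPolynomial σ K ⧸ I)).colon
        {Ideal.Quotient.mk I (monomial b 1)} := by
    ext f
    rw [mem_ideal_span_X_image, Submodule.mem_colon_singleton, Submodule.mem_bot,
      ← Ideal.Quotient.mk_eq_mk, ← Submodule.Quotient.mk_smul, Submodule.Quotient.mk_eq_zero,
      smul_eq_mul, hI.mul_monomial_mem_iff]
    constructor
    · intro h v hv
      obtain ⟨i, hi, hvi⟩ := h v (mem_support_iff.2 hv)
      have := Ideal.mul_mem_left I (monomial (v - Finsupp.single i 1) 1) (hF' i (by simpa using hi))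
      rwa [monomial_mul, one_mul, ← add_assoc, tsub_add_cancel_of_le] at this
      simpa [Nat.one_le_iff_ne_zero] using hvi
    · intro h v hv
      by_contra! hcon
      refine hF v (fun i hi => ?_) (h v (mem_support_iff.1 hv))
      by_contra hiF
      exact hi (hcon i (by simpa using hiF))
  have := isPrime_span_X_image (K := K) ((Fᶜ : Finset σ) : Set σ)
  have := isPrime_span_X_image (K := K) (Set.univ : Set σ)
  have h1 := length_add_height_le_of_isWeaklyRegular rs hrs hreg
    (Ideal.span_mono (Set.image_mono (Set.subset_univ _))) hcolon
  have h2 := height_span_X_image_le (K := K) (Finset.univ : Finset σ)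
  rw [Finset.coe_univ] at h2
  have h3 : ((rs.length + (Fᶜ).card : ℕ) : ℕ∞) ≤ (Finset.univ : Finset σ).card := by
    push_cast
    exact (add_le_add_right (card_le_height_span_X_image _) _).trans (h1.trans h2)
  rw [Nat.cast_le] at h3
  have := F.card_add_card_compl
  rw [Finset.card_univ] at h3
  omega

/-- If `S ⧸ I` admits a regular sequence of length two, then no standard monomial `x^a` has its
nonvanishing directions split into two parts `C`, `C'` with all the mixed products vanishing. -/
theorem not_separated [Finite σ] (hI : IsMonomialIdeal I) {f g : MvPolynomial σ K}
    (hf : f ∈ Ideal.span (X '' (Set.univ : Set σ) : Set (MvPolynomial σ K)))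
    (hg : g ∈ Ideal.span (X '' (Set.univ : Set σ) : Set (MvPolynomial σ K)))
    (hreg : RingTheory.Sequence.IsWeaklyRegular (MvPolynomial σ K ⧸ I) [f, g])
    {a : σ →₀ ℕ} {C : Set σ} {N : ℕ} {i j : σ} (hi : i ∈ C) (hj : j ∉ C)
    (hia : monomial (Finsupp.single i N + a) (1 : K) ∉ I)
    (hja : monomial (Finsupp.single j N + a) (1 : K) ∉ I) :
    ∃ k ∈ C, ∃ l ∉ C,
      monomial (Finsupp.single k N + (Finsupp.single l N + a)) (1 : K) ∉ I := by
  classical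
  by_contra! hcon
  rw [RingTheory.Sequence.isWeaklyRegular_cons_iff, RingTheory.Sequence.isWeaklyRegular_cons_iff]
    at hreg
  let P (D : Set σ) : Ideal (MvPolynomial σ K) := Ideal.span ((fun i => X i ^ N) '' D)
  have hP : ∀ D, ∀ i ∈ D, monomial (Finsupp.single i N) (1 : K) ∈ P D := fun D i hi =>
    Ideal.subset_span ⟨i, hi, by simp [X_pow_eq_monomial]⟩
  have hrad : Ideal.span (X '' (Set.univ : Set σ) : Set (MvPolynomial σ K)) ≤
      (P C ⊔ P Cᶜ).radical := by
    rw [Ideal.span_le]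
    rintro _ ⟨k, -, rfl⟩
    refine ⟨N, ?_⟩
    by_cases hk : k ∈ C
    · exact Ideal.mem_sup_left (Ideal.subset_span ⟨k, hk, rfl⟩)
    · exact Ideal.mem_sup_right (Ideal.subset_span ⟨k, hk, rfl⟩)
  have hPP : ∀ p ∈ P C, ∀ q ∈ P Cᶜ,
      (p * q) • (Ideal.Quotient.mk I (monomial a 1)) = 0 := by
    intro p hp q hq
    rw [← Ideal.Quotient.mk_eq_mk, ← Submodule.Quotient.mk_smul, Submodule.Quotient.mk_eq_zero,
      smul_eq_mul]
    have hle : P C * P Cᶜ ≤ (I.colon {monomial a 1} : Ideal (MvPolynomial σ K)) := by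
      rw [Ideal.span_mul_span', Ideal.span_le]
      rintro _ ⟨_, ⟨k, hk, rfl⟩, _, ⟨l, hl, rfl⟩, rfl⟩
      simpa [Submodule.mem_colon_singleton, X_pow_eq_monomial, monomial_mul, add_assoc]
        using hcon k hk l hl
    simpa [Submodule.mem_colon_singleton] using hle (Ideal.mul_mem_mul hp hq)
  obtain ⟨s, hs, hs'⟩ := exists_extension_of_isSMulRegular hreg.1 hreg.2.1 (hrad hf) (hrad hg) hPP
  obtain ⟨s, rfl⟩ := Ideal.Quotient.mk_surjective s
  have h1 := hs _ (hP C i hi)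
  have h2 := hs' _ (hP Cᶜ j hj)
  rw [← Ideal.Quotient.mk_eq_mk, ← Submodule.Quotient.mk_smul] at h1 h2
  rw [← Ideal.Quotient.mk_eq_mk, ← Submodule.Quotient.mk_smul, Submodule.Quotient.eq,
    smul_eq_mul, smul_eq_mul, ← mul_sub, hI.mem_iff] at h1
  rw [Submodule.Quotient.mk_eq_zero, smul_eq_mul, hI.mem_iff] at h2
  have h3 : coeff a s = 0 := by
    by_contra h
    exact hja (h2 _ (by rwa [coeff_monomial_mul, one_mul]))
  refine hia (h1 _ ?_)
  rw [coeff_monomial_mul, one_mul, coeff_sub, h3, coeff_monomial]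
  simp

end IsMonomialIdeal

/-- The translate `e + ℕ^Z` of a coordinate orthant. -/
def orthant {σ : Type*} (e : σ → ℕ) (Z : Finset σ) : Set (σ → ℕ) :=
  {a | e ≤ a ∧ ∀ i ∉ Z, a i = e i}

/-- `A` is a finite disjoint union of translated orthants of dimension at least `d`. -/
inductive HasStanleyPartition {σ : Type*} (d : ℕ) : Set (σ → ℕ) → Prop
  | empty : HasStanleyPartition d ∅
  | orthant (e : σ → ℕ) (Z : Finset σ) (h : d ≤ Z.card) : HasStanleyPartition d (orthant e Z)
  | union (A B : Set (σ → ℕ)) (hA : HasStanleyPartition d A) (hB : HasStanleyPartition d B)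
      (h : Disjoint A B) : HasStanleyPartition d (A ∪ B)

namespace HasStanleyPartition

variable {σ : Type*} {d : ℕ}

theorem biUnion {α : Type*} (s : Finset α) (f : α → Set (σ → ℕ))
    (hf : ∀ x ∈ s, HasStanleyPartition d (f x)) (hd : (s : Set α).PairwiseDisjoint f) :
    HasStanleyPartition d (⋃ x ∈ s, f x) := by
  classical
  induction s using Finset.induction_on with
  | empty => simpa using empty
  | insert x s hx ih =>
    rw [Finset.set_biUnion_insert]
    refine union _ _ (hf x (by simp))
      (ih (fun y hy => hf y (by simp [hy])) (hd.subset (by simp))) ?_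
    rw [Set.disjoint_iUnion₂_right]
    intro y hy
    exact hd (by simp) (by simp [hy]) (by rintro rfl; exact hx hy)

theorem of_fibers {α : Type*} (s : Finset α) {A : Set (σ → ℕ)} (ρ : (σ → ℕ) → α)
    (hρ : ∀ a ∈ A, ρ a ∈ s) (h : ∀ c ∈ s, HasStanleyPartition d {a | a ∈ A ∧ ρ a = c}) :
    HasStanleyPartition d A := by
  have := biUnion s (fun c => {a | a ∈ A ∧ ρ a = c}) h fun c _ c' _ hcc' =>
    Set.disjoint_left.2 fun a ha ha' => hcc' (ha.2.symm.trans ha'.2)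
  convert this using 1
  ext a
  simp only [Set.mem_iUnion, Set.mem_ofPred_eq, exists_prop]
  exact ⟨fun ha => ⟨_, hρ a ha, ha, rfl⟩, fun ⟨_, _, ha, _⟩ => ha⟩

theorem translate {A : Set (σ → ℕ)} (hA : HasStanleyPartition d A) (u : σ → ℕ) :
    HasStanleyPartition d ((u + ·) '' A) := by
  induction hA with
  | empty => simpa using empty
  | orthant e Z h =>
    convert orthant (u + e) Z h using 1
    ext a
    constructor
    · rintro ⟨b, hb, rfl⟩
      exact ⟨add_le_add_right hb.1 u, fun i hi => by simp [hb.2 i hi]⟩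
    · intro ha
      have hua : u ≤ a := le_self_add.trans ha.1
      refine ⟨a - u, ⟨le_tsub_of_add_le_left ha.1, fun i hi => ?_⟩, add_tsub_cancel_of_le hua⟩
      simp [ha.2 i hi]
  | union A B _ _ h hA hB =>
    rw [Set.image_union]
    exact union _ _ hA hB ((Set.disjoint_image_iff (add_right_injective u)).2 h)

theorem zero_of_truncated [Finite σ] {A : Set (σ → ℕ)} {N : ℕ}
    (hA : ∀ a b, b ∈ A → (∀ i, min (a i) N = min (b i) N) → a ∈ A) :
    HasStanleyPartition 0 A := by
  classical
  have := Fintype.ofFinite σ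
  refine of_fibers (Finset.Iic fun _ => N) (fun a i => min (a i) N)
    (fun a _ => Finset.mem_Iic.2 fun i => min_le_right _ _) fun c _ => ?_
  rcases Set.eq_empty_or_nonempty {a | a ∈ A ∧ (fun i => min (a i) N) = c} with h | ⟨b, hb, rfl⟩
  · rw [h]
    exact empty
  convert orthant (fun i => min (b i) N) (Finset.univ.filter fun i => min (b i) N = N)
    (Nat.zero_le _) using 1
  ext a
  constructor
  · rintro ⟨-, h⟩
    refine ⟨fun i => ?_, fun i hi => ?_⟩
    · have := congrFun h i
      dsimp only at this ⊢
      omega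
    · have := congrFun h i
      simp only [Finset.mem_filter, Finset.mem_univ, true_and] at hi
      dsimp only at this ⊢
      omega
  · rintro ⟨h1, h2⟩
    have key : ∀ i, min (a i) N = min (b i) N := by
      intro i
      have h1 := h1 i
      have h2 := h2 i
      simp only [Finset.mem_filter, Finset.mem_univ, true_and] at h1 h2
      by_cases h : min (b i) N = N
      · omega
      · have := h2 h
        omega
    exact ⟨hA a b hb key, funext key⟩

theorem one_of_truncated [Finite σ] [DecidableEq σ] {A : Set (σ → ℕ)} {N : ℕ}
    (hA : ∀ a b, b ∈ A → (∀ i, min (a i) N = min (b i) N) → a ∈ A) (i : σ)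
    (hi : ∀ a t, a ∈ A → a i ≤ t → Function.update a i t ∈ A) :
    HasStanleyPartition 1 A := by
  have := Fintype.ofFinite σ
  let τ (a : σ → ℕ) : ℕ := sInf {t | Function.update a i t ∈ A}
  have hτ : ∀ a ∈ A, Function.update a i (τ a) ∈ A := fun a ha =>
    Nat.sInf_mem (s := {t | Function.update a i t ∈ A}) ⟨a i, by simpa using ha⟩
  have hτN : ∀ a ∈ A, τ a ≤ a i ∧ τ a ≤ N := by
    intro a ha
    refine ⟨Nat.sInf_le (by simpa using ha), (Nat.sInf_le (m := min (a i) N) ?_).trans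
      (min_le_right _ _)⟩
    refine hA _ a ha fun j => ?_
    rcases eq_or_ne j i with rfl | hj
    · simp
    · simp [hj]
  refine of_fibers (Finset.Iic fun _ => N)
    (fun a => Function.update (fun i => min (a i) N) i (τ a))
    (fun a ha => Finset.mem_Iic.2 fun j => ?_) fun c _ => ?_
  · rcases eq_or_ne j i with rfl | hj
    · simpa using (hτN a ha).2
    · simp [hj]
  rcases Set.eq_empty_or_nonempty
    {a | a ∈ A ∧ Function.update (fun i => min (a i) N) i (τ a) = c} with h | ⟨b, hb, rfl⟩
  · rw [h]
    exact empty
  convert orthant (Function.update (fun i => min (b i) N) i (τ b))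
    (insert i (Finset.univ.filter fun i => min (b i) N = N))
    (Finset.one_le_card.2 (Finset.insert_nonempty _ _)) using 1
  ext a
  constructor
  · rintro ⟨ha, h⟩
    refine ⟨fun j => ?_, fun j hj => ?_⟩ <;> have hj' := congrFun h j
    · rcases eq_or_ne j i with rfl | hji
      · rw [← h]
        simpa using (hτN a ha).1
      · simp only [Function.update_of_ne hji] at hj' ⊢
        omega
    · simp only [Finset.mem_insert, Finset.mem_filter, Finset.mem_univ, true_and, not_or] at hj
      simp only [Function.update_of_ne hj.1] at hj' ⊢
      omega
  · rintro ⟨h1, h2⟩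
    have key : ∀ j ≠ i, min (a j) N = min (b j) N := by
      intro j hj
      have h1 := h1 j
      have h2 := h2 j
      simp only [Finset.mem_insert, Finset.mem_filter, Finset.mem_univ, true_and, not_or,
        Function.update_of_ne hj] at h1 h2
      by_cases h : min (b j) N = N
      · omega
      · have := h2 ⟨hj, h⟩
        omega
    have key' : ∀ t, ∀ j, min (Function.update a i t j) N = min (Function.update b i t j) N := by
      intro t j
      rcases eq_or_ne j i with rfl | hj
      · simp
      · simpa [hj] using key j hj
    have hab : τ a = τ b := congrArg sInf (Set.ext fun t =>
      ⟨fun h => hA _ _ h fun j => (key' t j).symm, fun h => hA _ _ h (key' t)⟩)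
    have ha : Function.update a i (τ b) ∈ A := hA _ _ (hτ b hb) (key' _)
    have h1i := h1 i
    simp only [Function.update_self] at h1i
    refine ⟨by simpa using hi _ (a i) ha (by simpa using h1i), ?_⟩
    ext j
    rcases eq_or_ne j i with rfl | hj
    · simp [hab]
    · simpa [hj] using key j hj

theorem of_exists_lt [Fintype σ] [LinearOrder σ] (W : Finset σ) (n : σ → ℕ)
    (hd : d + W.card + 1 ≤ Fintype.card σ) :
    HasStanleyPartition d {a : σ → ℕ | (∀ i ∈ W, a i = 0) ∧ ∃ j ∉ W, a j < n j} := by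
  let e (p : (_ : σ) × ℕ) : σ → ℕ := fun k =>
    if k ∈ W then 0 else if k = p.1 then p.2 else if k < p.1 then n k else 0
  let f (p : (_ : σ) × ℕ) := _root_.orthant (e p) (insert p.1 W)ᶜ
  have hf : ∀ p a, p.1 ∉ W → (a ∈ f p ↔
      (∀ i ∈ W, a i = 0) ∧ a p.1 = p.2 ∧ ∀ k < p.1, k ∉ W → n k ≤ a k) := by
    intro p a hp
    constructor
    · rintro ⟨h1, h2⟩
      refine ⟨fun i hi => ?_, ?_, fun k hk hkW => ?_⟩
      · simpa [e, hi] using h2 i (by simp [hi])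
      · simpa [e, hp] using h2 p.1 (by simp)
      · simpa [e, hkW, hk.ne, hk] using h1 k
    · rintro ⟨h1, h2, h3⟩
      refine ⟨fun k => ?_, fun k hk => ?_⟩
      · dsimp only [e]
        split_ifs with hkW hkp hlt
        · exact Nat.zero_le _
        · rw [hkp, h2]
        · exact h3 k hlt hkW
        · exact Nat.zero_le _
      · simp only [Finset.mem_compl, Finset.mem_insert, not_not] at hk
        rcases hk with rfl | hk
        · simp [e, hp, h2]
        · simp [e, hk, h1 k hk]
  have h := biUnion (d := d) (Wᶜ.sigma fun j => Finset.range (n j)) f ?_ ?_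
  · convert h using 1
    ext a
    simp only [Set.mem_ofPred_eq, Set.mem_iUnion, exists_prop, Finset.mem_sigma, Finset.mem_compl,
      Finset.mem_range]
    constructor
    · rintro ⟨hW, hj⟩
      have hne : (Finset.univ.filter fun j => j ∉ W ∧ a j < n j).Nonempty := by
        obtain ⟨j, hj⟩ := hj
        exact ⟨j, by simpa using hj⟩
      have hmem := Finset.min'_mem _ hne
      rw [Finset.mem_filter] at hmem
      refine ⟨⟨_, a _⟩, hmem.2, (hf _ _ hmem.2.1).2 ⟨hW, rfl, fun k hk hkW => ?_⟩⟩
      by_contra! hlt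
      exact (Finset.min'_le _ k (by simp [hkW, hlt])).not_gt hk
    · rintro ⟨p, hp, ha⟩
      obtain ⟨h1, h2, -⟩ := (hf p a hp.1).1 ha
      exact ⟨h1, p.1, hp.1, h2 ▸ hp.2⟩
  · intro p hp
    rw [Finset.mem_sigma, Finset.mem_compl] at hp
    refine orthant _ _ ?_
    rw [Finset.card_compl, Finset.card_insert_of_notMem hp.1]
    omega
  · rintro ⟨j, t⟩ hp ⟨j', t'⟩ hp' hne
    simp only [Finset.coe_sigma, Set.mem_sigma_iff, Finset.coe_compl, Set.mem_compl_iff,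
      Finset.mem_coe, Finset.mem_range] at hp hp'
    refine Set.disjoint_left.2 fun a ha ha' => ?_
    obtain ⟨-, h2, h3⟩ := (hf _ a hp.1).1 ha
    obtain ⟨-, h2', h3'⟩ := (hf _ a hp'.1).1 ha'
    dsimp only at h2 h3 h2' h3'
    rcases lt_trichotomy j j' with hlt | rfl | hlt
    · have := h3' j hlt hp.1
      omega
    · exact hne (by rw [← h2, ← h2'])
    · have := h3 j' hlt hp'.1
      omega

end HasStanleyPartition

/-- Raise the coordinates in `F` to `N`. -/
def fill {σ : Type*} [DecidableEq σ] (N : ℕ) (F : Finset σ) (a : σ → ℕ) : σ → ℕ :=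
  fun i => if i ∈ F then N else a i

/-- `A` is a lower set, and membership in `A` is insensitive to truncating exponents at `N`. -/
def IsTruncatedLower {σ : Type*} (N : ℕ) (A : Set (σ → ℕ)) : Prop :=
  ∀ a b, b ∈ A → (∀ i, min (a i) N ≤ b i) → a ∈ A

/-- Combinatorial form of the connectedness forced by a regular sequence of length two: two
complementary coordinate planes through a point of `A` are linked by a third one. -/
def HasLinkedPlanes (N : ℕ) (A : Set (Fin 4 → ℕ)) : Prop :=
  ∀ a i j k l, i ≠ j → i ≠ k → i ≠ l → j ≠ k → j ≠ l → k ≠ l →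
    fill N {i, j} a ∈ A → fill N {k, l} a ∈ A →
    fill N {i, k} a ∈ A ∨ fill N {i, l} a ∈ A ∨ fill N {j, k} a ∈ A ∨ fill N {j, l} a ∈ A

namespace IsTruncatedLower

variable {σ : Type*} {N : ℕ} {A : Set (σ → ℕ)}

theorem mem_of_le (hA : IsTruncatedLower N A) {a b : σ → ℕ} (hb : b ∈ A) (hab : a ≤ b) : a ∈ A :=
  hA a b hb fun i => (min_le_left _ _).trans (hab i)

theorem shift (hA : IsTruncatedLower N A) (u : σ → ℕ) : IsTruncatedLower N {a | u + a ∈ A} :=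
  fun a b hb h => hA _ _ hb fun i => by
    have := h i
    simp only [Pi.add_apply]
    omega

theorem fill_add [DecidableEq σ] (hA : IsTruncatedLower N A) (F : Finset σ) (u a : σ → ℕ) :
    u + fill N F a ∈ A ↔ fill N F (u + a) ∈ A := by
  constructor <;> refine fun h => hA _ _ h fun i => ?_ <;>
    · simp only [fill, Pi.add_apply]
      split_ifs <;> omega

theorem eq_image_union_shift (A : Set (σ → ℕ)) (u : σ → ℕ) (hu : ∀ a, ¬ u ≤ a → a ∈ A) :
    A = {a | ¬ u ≤ a} ∪ (u + ·) '' {a | u + a ∈ A} := by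
  ext a
  by_cases h : u ≤ a
  · constructor
    · intro ha
      exact Or.inr ⟨a - u, by simpa [add_tsub_cancel_of_le h] using ha, add_tsub_cancel_of_le h⟩
    · rintro (h' | ⟨b, hb, rfl⟩)
      · exact absurd h h'
      · exact hb
  · simp [h, hu a h]

end IsTruncatedLower

theorem HasLinkedPlanes.shift {N : ℕ} {A : Set (Fin 4 → ℕ)} (h : HasLinkedPlanes N A)
    (hA : IsTruncatedLower N A) (u : Fin 4 → ℕ) : HasLinkedPlanes N {a | u + a ∈ A} := by
  intro a i j k l
  simp only [Set.mem_ofPred_eq, hA.fill_add]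
  exact h _ i j k l

/-- A `4 × 4` table cannot have every row beaten, off the diagonal, in each of its entries but one,
and matched in the remaining one. -/
theorem exists_row_not_dominated (n : Fin 4 → Fin 4 → ℕ) :
    ∃ i, ∀ m k, m ≠ i → k ≠ i → k ≠ m → n i m ≤ n k m →
      ∃ j, j ≠ i ∧ j ≠ m ∧ ∀ r, r ≠ i → r ≠ j → n r j ≤ n i j := by
  by_contra! h
  choose m k hm hk hkm hle hlt using h
  have hmax : ∀ j i, i ≠ j → (∀ r, r ≠ j → n r j ≤ n i j) → m i = j := by
    intro j i hij hr
    by_contra hne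
    obtain ⟨r, -, hrj, hlt⟩ := hlt i j hij.symm (Ne.symm hne)
    exact absurd (hr r hrj) (not_le.2 hlt)
  have h2 : ∀ j, 2 ≤ (Finset.univ.filter fun i => m i = j).card := by
    intro j
    obtain ⟨i, hi, hir⟩ := Finset.exists_max_image (Finset.univ.erase j) (fun i => n i j)
      (Finset.card_pos.1 (by simp))
    simp only [Finset.mem_erase, Finset.mem_univ, and_true] at hi hir
    have hmi : m i = j := hmax j i hi hir
    have hmk : m (k i) = j := by
      refine hmax j _ (hmi ▸ hkm i) fun r hr => (hir r hr).trans ?_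
      have := hle i
      rwa [hmi] at this
    exact Finset.one_lt_card.2 ⟨i, by simp [hmi], k i, by simp [hmk], (hk i).symm⟩
  have hcard := Finset.card_eq_sum_card_fiberwise (f := m) (s := Finset.univ) (t := Finset.univ)
    (fun _ _ => Finset.mem_coe.2 (Finset.mem_univ _))
  have := Finset.sum_le_sum (s := Finset.univ) fun j _ => h2 j
  simp at hcard this
  omega

namespace HasStanleyPartition

variable {N : ℕ}

theorem slice_eq {A : Set (Fin 4 → ℕ)} (hA : IsTruncatedLower N A)
    (hP : ∀ a ∈ A, ∃ F : Finset (Fin 4), 2 ≤ F.card ∧ fill N F a ∈ A)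
    (hz : ∀ i, ∃ b ∉ A, b i = 0) (hL : HasLinkedPlanes N A) :
    ∃ (i : Fin 4) (n : Fin 4 → ℕ), ({a | a ∈ A ∧ a i = 0} : Set (Fin 4 → ℕ)) =
      {a | (∀ k ∈ ({i} : Finset (Fin 4)), a k = 0) ∧ ∃ j ∉ ({i} : Finset (Fin 4)), a j < n j} := by
  let pt (i j : Fin 4) (q : ℕ) : Fin 4 → ℕ := fun k => if k = i then 0 else if k = j then q else N
  let n (i j : Fin 4) : ℕ := sInf {q | pt i j q ∉ A}
  have hzN : ∀ i j, pt i j N ∉ A := by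
    intro i j h
    obtain ⟨b, hb, hbi⟩ := hz i
    refine hb (hA _ _ h fun k => ?_)
    dsimp only [pt]
    split_ifs with hk <;> simp [*]
  have hlt : ∀ i j q, pt i j q ∈ A ↔ q < n i j := by
    intro i j q
    constructor
    · intro h
      by_contra! hle
      refine (Nat.sInf_mem (s := {q | pt i j q ∉ A}) ⟨N, hzN i j⟩) (hA.mem_of_le h fun k => ?_)
      dsimp only [pt]
      split_ifs
      · exact le_rfl
      · exact hle
      · exact le_rfl
    · intro h
      by_contra hq
      exact absurd (Nat.sInf_le (s := {q | pt i j q ∉ A}) hq) (not_le.2 h)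
  obtain ⟨i, hi⟩ := exists_row_not_dominated n
  refine ⟨i, n i, Set.ext fun a => ?_⟩
  simp only [Set.mem_ofPred_eq, Finset.mem_singleton, forall_eq]
  rw [and_comm]
  refine and_congr_right fun hai => ⟨fun ha => ?_, ?_⟩
  swap
  · rintro ⟨j, hji, hj⟩
    refine hA _ _ ((hlt i j _).2 hj) fun k => ?_
    dsimp only [pt]
    split_ifs with h h' <;> simp [*]
  by_contra! hge
  obtain ⟨F, hF, haF⟩ := hP a ha
  have hnN : ∀ i j, n i j ≤ N := fun i j => Nat.sInf_le (hzN i j)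
  clear_value n
  have hiF : ∀ l, l ≠ i → ∃ k, k ≠ i ∧ k ≠ l ∧ k ∉ F := by
    intro l hl
    by_contra! h
    refine absurd ((hlt i l (a l)).1 (hA _ _ haF fun k => ?_)) (not_lt.2 (hge l hl))
    dsimp only [pt, fill]
    split_ifs with h1 h2 h3 h4 <;> first | omega | skip
    all_goals simp_all
  obtain ⟨p, hpi⟩ := exists_ne i
  obtain ⟨k, hki, -, hkF⟩ := hiF p hpi
  obtain ⟨l, hli, hlk, hlF⟩ := hiF k hki
  have hFeq : F = {k, l}ᶜ := by
    refine Finset.eq_of_subset_of_card_le (fun r hr => ?_) ?_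
    · simp only [Finset.mem_compl, Finset.mem_insert, Finset.mem_singleton, not_or]
      exact ⟨fun h => hkF (h ▸ hr), fun h => hlF (h ▸ hr)⟩
    · rw [Finset.card_compl, Finset.card_pair hlk.symm]
      exact hF
  have hiF' : i ∈ F := by simp [hFeq, hki.symm, hli.symm]
  obtain ⟨m, hmF, hmi⟩ := Finset.exists_mem_ne hF i
  have hkm : k ≠ m := fun h => hkF (h ▸ hmF)
  have hlm : l ≠ m := fun h => hlF (h ▸ hmF)
  have hall : ∀ r, r = i ∨ r = m ∨ r = k ∨ r = l := by omega
  have hne : (m ≠ i ∧ k ≠ i ∧ l ≠ i ∧ k ≠ m ∧ l ≠ m ∧ l ≠ k) ∧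
      (i ≠ m ∧ i ≠ k ∧ i ≠ l ∧ m ≠ k ∧ m ≠ l ∧ k ≠ l) :=
    ⟨⟨hmi, hki, hli, hkm, hlm, hlk⟩, hmi.symm, hki.symm, hli.symm, hkm.symm, hlm.symm, hlk.symm⟩
  have hb : (fun r => if r = k then n i k else if r = l then n i l else N) ∈ A := by
    refine hA _ _ haF fun r => ?_
    have h1 := hge k hki
    have h2 := hge l hli
    dsimp only [fill]
    rcases hall r with h | h | h | h <;>
      simp [h, hne, hiF', hmF, hkF, hlF, h1, h2]
  have hil : n i l < n k l := (hlt k l _).1 <| hA _ _ hb fun r => by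
    dsimp only [pt]
    split_ifs <;> omega
  have hik : n i k < n l k := (hlt l k _).1 <| hA _ _ hb fun r => by
    dsimp only [pt]
    split_ifs <;> omega
  have hex : n i m ≤ n k m ∨ n i m ≤ n l m := by
    rcases Nat.eq_zero_or_pos (n i m) with h0 | hpos
    · simp [h0]
    have h1 := hL (fun r => if r = i then 0 else if r = m then n i m - 1 else n i r) i m k l
      hmi.symm hki.symm hli.symm hkm.symm hlm.symm hlk.symm
      (hA _ _ hb fun r => by
        dsimp only [fill]
        rcases hall r with h | h | h | h <;> simp [h, hne, hnN])
      (hA _ _ ((hlt i m (n i m - 1)).2 (by omega)) fun r => by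
        dsimp only [fill, pt]
        rcases hall r with h | h | h | h <;> simp [h, hne, hnN])
    rcases h1 with h | h | h | h
    · have := (hlt l m (n i m - 1)).1 (hA _ _ h fun r => by
        dsimp only [fill, pt]
        rcases hall r with h | h | h | h <;> simp [h, hne, hnN])
      omega
    · have := (hlt k m (n i m - 1)).1 (hA _ _ h fun r => by
        dsimp only [fill, pt]
        rcases hall r with h | h | h | h <;> simp [h, hne, hnN])
      omega
    · have := (hlt i l (n i l)).1 (hA _ _ h fun r => by
        dsimp only [fill, pt]
        rcases hall r with h | h | h | h <;> simp [h, hne, hnN])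
      omega
    · have := (hlt i k (n i k)).1 (hA _ _ h fun r => by
        dsimp only [fill, pt]
        rcases hall r with h | h | h | h <;> simp [h, hne, hnN])
      omega
  have hfin : ∀ x, x ≠ i → x ≠ m → ¬ n i m ≤ n x m := by
    intro x hxi hxm hle
    obtain ⟨j, hji, hjm, hj⟩ := hi m x hmi hxi hxm hle
    rcases hall j with rfl | rfl | rfl | rfl
    · exact hji rfl
    · exact hjm rfl
    · exact absurd (hj l hli hlk) (not_le.2 hik)
    · exact absurd (hj k hki hlk.symm) (not_le.2 hil)
  exact hex.elim (hfin k hki hkm) (hfin l hli hlm)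

theorem two_of_linkedPlanes {A : Set (Fin 4 → ℕ)} (hA : IsTruncatedLower N A)
    (hP : ∀ a ∈ A, ∃ F : Finset (Fin 4), 2 ≤ F.card ∧ fill N F a ∈ A)
    (hz : ∀ i, ∃ b ∉ A, b i = 0) (hL : HasLinkedPlanes N A) : HasStanleyPartition 2 A := by
  induction hc : (A ∩ Set.Iic fun _ => N).ncard using Nat.strong_induction_on generalizing A with
  | _ c ih =>
  obtain rfl | ⟨a₀, ha₀⟩ := A.eq_empty_or_nonempty
  · exact empty
  obtain ⟨i, n, hslice⟩ := slice_eq hA hP hz hL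
  have hle : ∀ a, Pi.single i 1 + a ∈ A → a ∈ A := fun a ha => hA.mem_of_le ha le_add_self
  have hne : ∃ a ∈ A, Pi.single i 1 + a ∉ A := by
    by_contra! hcon
    have h0 : (0 : Fin 4 → ℕ) ∈ {a | a ∈ A ∧ a i = 0} := ⟨hA.mem_of_le ha₀ zero_le, rfl⟩
    rw [hslice] at h0
    obtain ⟨-, j, hj, hj'⟩ := h0
    rw [Finset.mem_singleton] at hj
    have h1 : ∀ t, (fun k => if k = i then t else if k = j then 0 else N) ∈ A := by
      intro t
      induction t with
      | zero =>
        have : (fun k => if k = i then 0 else if k = j then 0 else N) ∈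
            {a | a ∈ A ∧ a i = 0} := by
          rw [hslice]
          exact ⟨by simp, j, by simpa using hj, by simpa [hj] using hj'⟩
        exact this.1
      | succ t iht =>
        convert hcon _ iht using 1
        ext k
        by_cases hk : k = i
        · simp [hk, add_comm]
        · simp [hk]
    obtain ⟨b, hb, hbj⟩ := hz j
    refine hb (hA _ _ (h1 N) fun k => ?_)
    split_ifs with h h' <;> simp [*]
  obtain ⟨a, ha, ha'⟩ := hne
  have hlt : ({a | Pi.single i 1 + a ∈ A} ∩ Set.Iic fun _ => N).ncard < c := by
    rw [← hc]
    refine Set.ncard_lt_ncard ⟨Set.inter_subset_inter_left _ hle, fun hsub => ha' ?_⟩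
      ((Set.finite_Iic _).inter_of_right _)
    have h1 := hsub (a := fun k => min (a k) N)
      ⟨hA.mem_of_le ha fun k => min_le_left _ _, fun k => min_le_right _ _⟩
    refine hA _ _ h1.1 fun k => ?_
    simp only [Pi.add_apply]
    omega
  have h2 := ih _ hlt (hA.shift _) (fun a ha => ?_) (fun k => ?_) (hL.shift hA _) rfl
  · have h3 := of_exists_lt (d := 2) {i} n (by simp)
    rw [← hslice] at h3
    convert union _ _ h3 (h2.translate (Pi.single i 1)) ?_ using 1
    · ext b
      rcases Nat.eq_zero_or_pos (b i) with hb | hb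
      · constructor
        · exact fun h => Or.inl ⟨h, hb⟩
        · rintro (h | ⟨b, h, rfl⟩)
          · exact h.1
          · exact h
      · have hb' : Pi.single i 1 ≤ b := by
          intro k
          rcases eq_or_ne k i with rfl | hk
          · simpa [Nat.one_le_iff_ne_zero, Nat.pos_iff_ne_zero] using hb
          · simp [hk]
        constructor
        · intro h
          refine Or.inr ⟨b - Pi.single i 1, ?_, add_tsub_cancel_of_le hb'⟩
          rwa [Set.mem_ofPred_eq, add_tsub_cancel_of_le hb']
        · rintro (h | ⟨b, h, rfl⟩)
          · exact h.1
          · exact h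
    · rw [Set.disjoint_left]
      rintro _ ⟨-, hb⟩ ⟨b, -, rfl⟩
      simp at hb
  · obtain ⟨F, hF, h⟩ := hP _ ha
    exact ⟨F, hF, (hA.fill_add F _ a).2 h⟩
  · obtain ⟨b, hb, hbk⟩ := hz k
    exact ⟨b, fun h => hb (hle _ h), hbk⟩

theorem of_fill_mem {d : ℕ} {A : Set (Fin 4 → ℕ)} (hA : IsTruncatedLower N A)
    (hP : ∀ a ∈ A, ∃ F : Finset (Fin 4), d ≤ F.card ∧ fill N F a ∈ A)
    (hL : d = 2 → HasLinkedPlanes N A) : HasStanleyPartition d A := by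
  classical
  have htr : ∀ a b, b ∈ A → (∀ i, min (a i) N = min (b i) N) → a ∈ A := fun a b hb h =>
    hA _ _ hb fun i => (h i).le.trans (min_le_left _ _)
  obtain rfl | rfl | hd : d = 0 ∨ d = 1 ∨ 2 ≤ d := by omega
  · exact zero_of_truncated htr
  · let R (i : Fin 4) : Set (Fin 4 → ℕ) :=
      {a | fill N {i} a ∈ A ∧ ∀ j < i, fill N {j} a ∉ A}
    have hR : A = ⋃ i ∈ (Finset.univ : Finset (Fin 4)), R i := by
      ext a
      simp only [Finset.mem_univ, Set.iUnion_true, Set.mem_iUnion]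
      constructor
      · intro ha
        have hne : (Finset.univ.filter fun i => fill N {i} a ∈ A).Nonempty := by
          obtain ⟨F, hF, h⟩ := hP a ha
          obtain ⟨i, hi⟩ := Finset.card_pos.1 hF
          refine ⟨i, Finset.mem_filter.2 ⟨Finset.mem_univ _, hA _ _ h fun j => ?_⟩⟩
          simp only [fill, Finset.mem_singleton]
          split_ifs with h1 h2 <;> simp_all
        refine ⟨_, (Finset.mem_filter.1 (Finset.min'_mem _ hne)).2, fun j hj hjA => ?_⟩
        exact (Finset.min'_le _ j (by simpa using hjA)).not_gt hj
      · rintro ⟨i, hi, -⟩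
        refine hA _ _ hi fun j => ?_
        simp only [fill]
        split_ifs <;> simp
    rw [hR]
    refine biUnion _ _ (fun i _ => ?_) fun i _ j _ hij => ?_
    · refine one_of_truncated (N := N) (fun a b hb h => ?_) i fun a t ha hat => ?_
      · have key : ∀ k, fill N {k} a ∈ A ↔ fill N {k} b ∈ A := by
          intro k
          constructor <;> refine fun hk => htr _ _ hk fun j => ?_ <;>
            simp only [fill] <;> split_ifs <;> simp [h j]
        exact ⟨(key i).2 hb.1, fun j hj hja => hb.2 j hj ((key j).1 hja)⟩
      · refine ⟨hA.mem_of_le ha.1 fun j => ?_, fun j hj hja => ha.2 j hj ?_⟩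
        · simp only [fill, Finset.mem_singleton]
          split_ifs with h <;> simp [h]
        · refine hA.mem_of_le hja fun k => ?_
          simp only [fill, Finset.mem_singleton]
          split_ifs with h
          · exact le_rfl
          · rcases eq_or_ne k i with rfl | hk
            · simpa using hat
            · simp [hk]
    · refine Set.disjoint_left.2 fun a hi hj => ?_
      rcases lt_or_gt_of_ne hij with h | h
      · exact hj.2 i h hi.1
      · exact hi.2 j h hj.1
  · obtain rfl | ⟨a₀, ha₀⟩ := A.eq_empty_or_nonempty
    · exact empty
    have hd4 : d ≤ 4 := by
      obtain ⟨F, hF, -⟩ := hP a₀ ha₀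
      exact hF.trans (by simpa using F.card_le_univ)
    obtain rfl | hU := eq_or_ne A Set.univ
    · convert orthant (d := d) (0 : Fin 4 → ℕ) Finset.univ (by simpa using hd4) using 1
      ext a
      simp [_root_.orthant]
    obtain ⟨b₀, hb₀⟩ := Set.nonempty_compl.2 hU
    let u (i : Fin 4) : ℕ := sInf {t | ∃ b ∉ A, b i = t}
    have hu : ∀ b ∉ A, u ≤ b := fun b hb i => Nat.sInf_le ⟨b, hb, rfl⟩
    have hz : ∀ i, ∃ b ∉ {a | u + a ∈ A}, b i = 0 := by
      intro i
      obtain ⟨b, hb, hbi⟩ := Nat.sInf_mem (s := {t | ∃ b ∉ A, b i = t}) ⟨_, b₀, hb₀, rfl⟩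
      refine ⟨b - u, by simpa [add_tsub_cancel_of_le (hu b hb)] using hb, ?_⟩
      rw [Pi.sub_apply, hbi]
      exact Nat.sub_self _
    have hP' : ∀ a ∈ {a | u + a ∈ A}, ∃ F : Finset (Fin 4),
        d ≤ F.card ∧ fill N F a ∈ {a | u + a ∈ A} := by
      intro a ha
      obtain ⟨F, hF, h⟩ := hP _ ha
      exact ⟨F, hF, (hA.fill_add F u a).2 h⟩
    have hd3 : d ≤ 3 := by
      by_contra! hlt
      obtain ⟨F, hF, h⟩ := hP a₀ ha₀
      obtain rfl : F = Finset.univ := Finset.eq_univ_of_card F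
        (le_antisymm F.card_le_univ (by simpa using Nat.succ_le_of_lt (hlt.trans_le hF)))
      exact hb₀ (hA _ _ h fun i => by simp [fill])
    rw [IsTruncatedLower.eq_image_union_shift A u fun a ha => by_contra fun h => ha (hu a h)]
    refine union _ _ ?_ (translate ?_ u) (Set.disjoint_left.2 ?_)
    · convert of_exists_lt (d := d) ∅ u (by simpa using Nat.lt_succ_of_le hd3) using 1
      ext a
      simp [Pi.le_def]
    · obtain rfl | rfl : d = 2 ∨ d = 3 := by omega
      · exact two_of_linkedPlanes (hA.shift u) hP' hz ((hL rfl).shift hA u)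
      · convert empty using 1
        rw [Set.eq_empty_iff_forall_notMem]
        intro a ha
        obtain ⟨F, hF, h⟩ := hP' a ha
        obtain ⟨i, hi⟩ : ∃ i, ∀ j ≠ i, j ∈ F := by
          obtain rfl | hF' := eq_or_ne F Finset.univ
          · exact ⟨0, by simp⟩
          obtain ⟨i, hi⟩ : ∃ i, i ∉ F := by
            by_contra! h
            exact hF' (Finset.eq_univ_iff_forall.2 h)
          refine ⟨i, fun j hji => by_contra fun hj => ?_⟩
          have h2 : ({i, j} : Finset (Fin 4)) ⊆ Fᶜ := by
            simp [Finset.insert_subset_iff, hi, hj]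
          have h3 := Finset.card_le_card h2
          rw [Finset.card_pair hji.symm, Finset.card_compl, Fintype.card_fin] at h3
          omega
        obtain ⟨b, hb, hbi⟩ := hz i
        refine hb ((hA.shift u) _ _ h fun j => ?_)
        rcases eq_or_ne j i with rfl | hji
        · simp [hbi]
        · simp [fill, hi j hji]
    · rintro _ ha ⟨b, -, rfl⟩
      exact ha le_self_add

end HasStanleyPartition

namespace IsMonomialIdeal

open MvPolynomial

variable {σ K : Type*} [Field K] {I : Ideal (MvPolynomial σ K)}

/-- The exponents of the monomials outside `I`. -/
def stdExponents [Finite σ] (I : Ideal (MvPolynomial σ K)) : Set (σ → ℕ) :=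
  {a | monomial (Finsupp.equivFunOnFinite.symm a) (1 : K) ∉ I}

theorem coe_mem_stdExponents [Finite σ] {v : σ →₀ ℕ} :
    (v : σ → ℕ) ∈ stdExponents I ↔ monomial v (1 : K) ∉ I := by
  simp [stdExponents]

theorem exists_isTruncatedLower [Finite σ] (hI : IsMonomialIdeal I) :
    ∃ N, IsTruncatedLower N (stdExponents I) := by
  classical
  have := Fintype.ofFinite σ
  obtain ⟨G, hG, rfl⟩ := hI
  obtain ⟨G', hG', hspan⟩ :=
    Submodule.fg_span_iff_fg_span_finset_subset G |>.1 (IsNoetherian.noetherian (Ideal.span G))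
  have hT : {e | monomial e (1 : K) ∈ G'}.Finite :=
    G'.finite_toSet.preimage (monomial_left_injective one_ne_zero).injOn
  have himg : (G' : Set (MvPolynomial σ K)) =
      (fun e => monomial e (1 : K)) '' {e | monomial e (1 : K) ∈ G'} := by
    ext g
    constructor
    · intro hg
      obtain ⟨e, rfl⟩ := hG g (hG' hg)
      exact ⟨e, hg, rfl⟩
    · rintro ⟨e, he, rfl⟩
      exact he
  have hmem : ∀ v, monomial v (1 : K) ∈ Ideal.span G ↔ ∃ e, monomial e (1 : K) ∈ G' ∧ e ≤ v := by
    intro v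
    rw [show Ideal.span G = Ideal.span G' from hspan, himg, mem_ideal_span_monomial_image]
    simp [support_monomial]
  refine ⟨hT.toFinset.sup fun e => Finset.univ.sup e, fun a b hb hab ha => hb ?_⟩
  obtain ⟨e, he, hea⟩ := (hmem _).1 ha
  refine (hmem _).2 ⟨e, he, fun i => (le_min (hea i) ?_).trans (hab i)⟩
  exact (Finset.le_sup (f := e) (Finset.mem_univ i)).trans
    (Finset.le_sup (f := fun e : σ →₀ ℕ => Finset.univ.sup e) (hT.mem_toFinset.2 he))

theorem exists_fill_mem [Fintype σ] [DecidableEq σ] (hI : IsMonomialIdeal I) {N : ℕ}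
    (hN : IsTruncatedLower N (stdExponents I)) {rs : List (MvPolynomial σ K)}
    (hrs : ∀ r ∈ rs, r ∈ Ideal.span (X '' (Set.univ : Set σ) : Set (MvPolynomial σ K)))
    (hreg : RingTheory.Sequence.IsWeaklyRegular (MvPolynomial σ K ⧸ I) rs)
    {a : σ → ℕ} (ha : a ∈ stdExponents I) :
    ∃ F : Finset σ, rs.length ≤ F.card ∧ fill N F a ∈ stdExponents I := by
  have hfin : (stdExponents I ∩ Set.Iic fun _ => N).Finite := (Set.finite_Iic _).inter_of_right _
  obtain ⟨c, hac, hc⟩ := hfin.exists_le_maximal (a := fun i => min (a i) N)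
    ⟨hN.mem_of_le ha fun i => min_le_left _ _, fun i => min_le_right _ _⟩
  obtain ⟨⟨hcA, hcN⟩, hmax⟩ := hc
  refine ⟨Finset.univ.filter fun i => c i = N, hI.length_le_card hrs hreg
    (b := Finsupp.equivFunOnFinite.symm c) (fun v hv => coe_mem_stdExponents.1 ?_) fun i hi => ?_,
    hN _ _ hcA fun i => ?_⟩
  · refine hN _ _ hcA fun i => ?_
    have := hv i
    simp only [Finset.mem_filter, Finset.mem_univ, true_and] at this
    by_cases h : v i = 0
    · simp [h]
    · simp [this h]
  · by_contra h
    rw [← coe_mem_stdExponents] at h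
    simp only [Finset.mem_filter, Finset.mem_univ, true_and] at hi
    have := hmax (y := ((Finsupp.single i 1 + Finsupp.equivFunOnFinite.symm c : σ →₀ ℕ) : σ → ℕ))
      ⟨h, fun j => ?_⟩ (fun j => by simp) i
    · simp at this
    · have h1 := hcN j
      dsimp only at h1
      rcases eq_or_ne j i with rfl | hj
      · simp only [Finsupp.add_apply, Finsupp.single_eq_same,
          Finsupp.equivFunOnFinite_symm_apply_apply]
        omega
      · simpa [hj] using h1
  · have := hac i
    dsimp only [fill] at this ⊢
    simp only [Finset.mem_filter, Finset.mem_univ, true_and]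
    split_ifs with h
    · simp [h]
    · exact this

theorem hasLinkedPlanes {I : Ideal (MvPolynomial (Fin 4) K)} (hI : IsMonomialIdeal I) {N : ℕ}
    (hN : IsTruncatedLower N (stdExponents I)) {rs : List (MvPolynomial (Fin 4) K)}
    (hrs : ∀ r ∈ rs, r ∈ Ideal.span (X '' (Set.univ : Set (Fin 4)) :
      Set (MvPolynomial (Fin 4) K)))
    (hreg : RingTheory.Sequence.IsWeaklyRegular (MvPolynomial (Fin 4) K ⧸ I) rs)
    (hlen : rs.length = 2) : HasLinkedPlanes N (stdExponents I) := by
  obtain ⟨f, g, rfl⟩ := List.length_eq_two.1 hlen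
  intro a i j k l hij hik hil hjk hjl hkl h1 h2
  have hfill : ∀ p q, monomial (Finsupp.single p N + (Finsupp.single q N +
      Finsupp.equivFunOnFinite.symm a)) (1 : K) ∉ I → fill N {p, q} a ∈ stdExponents I := by
    intro p q h
    refine hN _ _ (coe_mem_stdExponents.2 h) fun r => ?_
    simp only [fill, Finset.mem_insert, Finset.mem_singleton]
    split_ifs with hr
    · rcases hr with rfl | rfl
      · simp
      · simp
        omega
    · simp; omega
  have hsingle : ∀ p (F : Finset (Fin 4)), p ∈ F → fill N F a ∈ stdExponents I →
      monomial (Finsupp.single p N + Finsupp.equivFunOnFinite.symm a) (1 : K) ∉ I := by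
    intro p F hp h
    refine coe_mem_stdExponents.1 (hN _ _ h fun r => ?_)
    rcases eq_or_ne r p with rfl | hr
    · simp [fill, hp]
    · simp only [fill]
      split_ifs <;> simp [hr]
  obtain ⟨p, hp, q, hq, h⟩ := hI.not_separated (hrs f (by simp)) (hrs g (by simp)) hreg
    (C := {i, j}) (i := i) (j := k) (N := N) (by simp) (by simp [hik.symm, hjk.symm])
    (hsingle i _ (by simp) h1) (hsingle k _ (by simp) h2)
  have h := hfill _ _ h
  simp only [Set.mem_insert_iff, Set.mem_singleton_iff, not_or] at hp hq
  obtain rfl | rfl : q = k ∨ q = l := by omega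
  all_goals rcases hp with rfl | rfl <;> simp [h]

theorem hasStanleyPartition {I : Ideal (MvPolynomial (Fin 4) K)} (hI : IsMonomialIdeal I)
    {rs : List (MvPolynomial (Fin 4) K)}
    (hrs : ∀ r ∈ rs, r ∈ Ideal.span (X '' (Set.univ : Set (Fin 4)) :
      Set (MvPolynomial (Fin 4) K)))
    (hreg : RingTheory.Sequence.IsWeaklyRegular (MvPolynomial (Fin 4) K ⧸ I) rs) :
    HasStanleyPartition rs.length (stdExponents I) := by
  obtain ⟨N, hN⟩ := hI.exists_isTruncatedLower
  exact .of_fill_mem hN (fun a ha => hI.exists_fill_mem hN hrs hreg ha)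
    (hI.hasLinkedPlanes hN hrs hreg)

end IsMonomialIdeal

theorem HasStanleyPartition.exists_fin {σ : Type*} {d : ℕ} {A : Set (σ → ℕ)}
    (hA : HasStanleyPartition d A) :
    ∃ (r : ℕ) (e : Fin r → σ → ℕ) (Z : Fin r → Finset σ), (∀ i, d ≤ (Z i).card) ∧
      Pairwise (Function.onFun Disjoint fun i => _root_.orthant (e i) (Z i)) ∧
      A = ⋃ i, _root_.orthant (e i) (Z i) := by
  induction hA with
  | empty => exact ⟨0, Fin.elim0, Fin.elim0, fun i => i.elim0, fun i => i.elim0, by simp⟩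
  | orthant e Z h =>
    exact ⟨1, fun _ => e, fun _ => Z, fun _ => h, fun i j h => absurd (Subsingleton.elim i j) h,
      by simp [Set.iUnion_const]⟩
  | union A B _ _ h hA hB =>
    obtain ⟨r, e, Z, h1, h2, rfl⟩ := hA
    obtain ⟨s, e', Z', h1', h2', rfl⟩ := hB
    have heq : ∀ i, _root_.orthant (Fin.append e e' i) (Fin.append Z Z' i) =
        Fin.append (fun i => _root_.orthant (e i) (Z i))
          (fun i => _root_.orthant (e' i) (Z' i)) i := by
      intro i
      refine Fin.addCases (fun i => ?_) (fun i => ?_) i <;> simp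
    refine ⟨r + s, Fin.append e e', Fin.append Z Z', fun i => ?_, fun i j => ?_, ?_⟩
    · refine Fin.addCases (fun i => ?_) (fun i => ?_) i <;> simp [h1, h1']
    · simp only [Function.onFun, heq]
      refine Fin.addCases (fun i => ?_) (fun i => ?_) i <;>
        refine Fin.addCases (fun j => ?_) (fun j => ?_) j <;> intro hij <;>
        simp only [Fin.append_left, Fin.append_right]
      · exact h2 fun h => hij (by rw [h])
      · exact h.mono (Set.subset_iUnion_of_subset i subset_rfl)
          (Set.subset_iUnion_of_subset j subset_rfl)
      · exact (h.mono (Set.subset_iUnion_of_subset j subset_rfl)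
          (Set.subset_iUnion_of_subset i subset_rfl)).symm
      · exact h2' fun h => hij (by rw [h])
    · simp only [heq]
      ext a
      simp only [Set.mem_union, Set.mem_iUnion]
      constructor
      · rintro (⟨i, hi⟩ | ⟨i, hi⟩)
        · exact ⟨Fin.castAdd s i, by simpa using hi⟩
        · exact ⟨Fin.natAdd r i, by simpa using hi⟩
      · rintro ⟨i, hi⟩
        revert hi
        refine Fin.addCases (fun i => ?_) (fun i => ?_) i <;> intro hi
        · exact Or.inl ⟨i, by simpa using hi⟩
        · exact Or.inr ⟨i, by simpa using hi⟩

theorem LinearIndependent.isInternal_span_image {ι κ K M : Type*} [Ring K] [Nontrivial K]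
    [AddCommGroup M] [Module K M] [DecidableEq κ] {b : ι → M} (hb : LinearIndependent K b)
    (hspan : Submodule.span K (Set.range b) = ⊤) {P : κ → Set ι}
    (hP : Pairwise (Function.onFun Disjoint P)) (hP' : ⋃ k, P k = Set.univ) :
    DirectSum.IsInternal fun k => Submodule.span K (b '' P k) := by
  rw [DirectSum.isInternal_submodule_iff_iSupIndep_and_iSup_eq_top]
  constructor
  · intro k
    simp only [← Submodule.span_iUnion, ← Set.image_iUnion]
    refine hb.disjoint_span_image ?_
    simp only [Set.disjoint_iUnion_right]
    exact fun j hj => hP hj.symm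
  · rw [← Submodule.span_iUnion, ← Set.image_iUnion, hP', Set.image_univ, hspan]

namespace IsMonomialIdeal

open MvPolynomial

variable {σ K : Type*} [Field K] {I : Ideal (MvPolynomial σ K)}

theorem linearIndependent_mk_monomial (hI : IsMonomialIdeal I) :
    LinearIndependent K fun v : {v : σ →₀ ℕ // monomial v (1 : K) ∉ I} =>
      Ideal.Quotient.mk I (monomial v.1 1) := by
  classical
  rw [linearIndependent_iff']
  intro s g hg v hv
  have h : ∑ w ∈ s, g w • monomial w.1 (1 : K) ∈ I := by
    rw [← Ideal.Quotient.eq_zero_iff_mem, map_sum, ← hg]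
    rfl
  by_contra hgv
  refine v.2 ((hI.mem_iff _).1 h v.1 ?_)
  rw [coeff_sum, Finset.sum_eq_single v]
  · simpa using hgv
  · intro w _ hwv
    simp [coeff_monomial, Subtype.coe_ne_coe.2 hwv]
  · exact fun h => absurd hv h

theorem span_range_mk_monomial (I : Ideal (MvPolynomial σ K)) :
    Submodule.span K (Set.range fun v : {v : σ →₀ ℕ // monomial v (1 : K) ∉ I} =>
      Ideal.Quotient.mk I (monomial v.1 1)) = ⊤ := by
  rw [eq_top_iff]
  rintro f -
  obtain ⟨f, rfl⟩ := Ideal.Quotient.mk_surjective f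
  rw [f.as_sum, map_sum]
  refine Submodule.sum_mem _ fun v _ => ?_
  have h : Ideal.Quotient.mk I (monomial v (coeff v f)) =
      coeff v f • Ideal.Quotient.mk I (monomial v 1) := by
    rw [← mul_one (coeff v f), ← smul_eq_mul, ← smul_monomial, smul_eq_mul, mul_one]
    rfl
  rw [h]
  refine Submodule.smul_mem _ _ ?_
  by_cases hv : monomial v (1 : K) ∈ I
  · rw [Ideal.Quotient.eq_zero_iff_mem.2 hv]
    exact Submodule.zero_mem _
  · exact Submodule.subset_span ⟨⟨v, hv⟩, rfl⟩

theorem exists_isInternal [Finite σ] (hI : IsMonomialIdeal I) {d : ℕ}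
    (hd : HasStanleyPartition d (stdExponents I)) :
    ∃ (r : ℕ) (e : Fin r → σ →₀ ℕ) (Z : Fin r → Finset σ), (∀ i, d ≤ (Z i).card) ∧
      DirectSum.IsInternal (fun i : Fin r => Submodule.span K
        {c : MvPolynomial σ K ⧸ I | ∃ v : σ →₀ ℕ, (∀ j, v j ≠ 0 → j ∈ Z i) ∧
          c = Ideal.Quotient.mk I (monomial (e i) 1 * monomial v 1)}) := by
  obtain ⟨r, e, Z, hZ, hdisj, hA⟩ := hd.exists_fin
  refine ⟨r, fun i => Finsupp.equivFunOnFinite.symm (e i), Z, hZ, ?_⟩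
  have heq : ∀ i, {c : MvPolynomial σ K ⧸ I | ∃ v : σ →₀ ℕ, (∀ j, v j ≠ 0 → j ∈ Z i) ∧
      c = Ideal.Quotient.mk I (monomial (Finsupp.equivFunOnFinite.symm (e i)) 1 * monomial v 1)} =
      (fun v : {v : σ →₀ ℕ // monomial v (1 : K) ∉ I} => Ideal.Quotient.mk I (monomial v.1 1)) ''
        {v | (v.1 : σ → ℕ) ∈ orthant (e i) (Z i)} := by
    intro i
    ext c
    constructor
    · rintro ⟨v, hv, rfl⟩
      have hv' : (Finsupp.equivFunOnFinite.symm (e i) + v : σ →₀ ℕ) ∈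
          {w : σ →₀ ℕ | (w : σ → ℕ) ∈ orthant (e i) (Z i)} :=
        ⟨fun j => by simp, fun j hj => by
          have : v j = 0 := by_contra fun h => hj (hv j h)
          simp [this]⟩
      refine ⟨⟨_, coe_mem_stdExponents.1 ?_⟩, hv', by simp [monomial_mul]⟩
      rw [hA]
      exact Set.mem_iUnion.2 ⟨i, hv'⟩
    · rintro ⟨v, hv, rfl⟩
      have hle : Finsupp.equivFunOnFinite.symm (e i) ≤ v.1 := fun j => hv.1 j
      refine ⟨v.1 - Finsupp.equivFunOnFinite.symm (e i), fun j hj => ?_, ?_⟩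
      · by_contra hjZ
        exact hj (by simp [hv.2 j hjZ])
      · rw [monomial_mul, add_tsub_cancel_of_le hle, one_mul]
  simp only [heq]
  exact hI.linearIndependent_mk_monomial.isInternal_span_image (span_range_mk_monomial I)
    (P := fun i => {v | (v.1 : σ → ℕ) ∈ orthant (e i) (Z i)})
    (fun i j hij => Set.disjoint_left.2 fun v hi hj => Set.disjoint_left.1 (hdisj hij) hi hj)
    (Set.eq_univ_of_forall fun v => by simpa [hA] using coe_mem_stdExponents.2 v.2)

theorem exists_mDepth_le {I : Ideal (MvPolynomial (Fin 4) K)} (hI : IsMonomialIdeal I) :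
    ∃ d : ℕ, mDepth (MvPolynomial (Fin 4) K)
      (Ideal.span (X '' (Set.univ : Set (Fin 4)))) (MvPolynomial (Fin 4) K ⧸ I) ≤ d ∧
      HasStanleyPartition d (stdExponents I) := by
  let L : Set ℕ := {n | ∃ rs : List (MvPolynomial (Fin 4) K), rs.length = n ∧
    (∀ r ∈ rs, r ∈ Ideal.span (X '' (Set.univ : Set (Fin 4)))) ∧
    RingTheory.Sequence.IsRegular (MvPolynomial (Fin 4) K ⧸ I) rs}
  obtain ⟨N, hN⟩ := hI.exists_isTruncatedLower
  have hbdd : BddAbove L := by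
    refine ⟨4, ?_⟩
    rintro _ ⟨rs, rfl, hrs, hreg⟩
    have := hreg.nontrivial
    have h0 : (0 : Fin 4 → ℕ) ∈ stdExponents I := by
      intro h
      rw [show Finsupp.equivFunOnFinite.symm (0 : Fin 4 → ℕ) = 0 from Finsupp.ext fun _ => rfl,
        ← Ideal.Quotient.eq_zero_iff_mem] at h
      exact one_ne_zero h
    obtain ⟨F, hF, -⟩ := hI.exists_fill_mem hN hrs hreg.toIsWeaklyRegular h0
    exact hF.trans (by simpa using F.card_le_univ)
  rcases L.eq_empty_or_nonempty with hL | hL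
  · refine ⟨0, sSup_le ?_, ?_⟩
    · rintro _ ⟨rs, rfl, h⟩
      exact absurd (show rs.length ∈ L from ⟨rs, rfl, h⟩) (by simp [hL])
    · exact hI.hasStanleyPartition (rs := []) (by simp) (.nil _ _)
  · obtain ⟨rs, hlen, hrs, hreg⟩ := Nat.sSup_mem hL hbdd
    refine ⟨sSup L, sSup_le ?_, hlen ▸ hI.hasStanleyPartition hrs hreg.toIsWeaklyRegular⟩
    rintro _ ⟨rs', rfl, h⟩
    exact Nat.cast_le.2 (le_csSup hbdd ⟨rs', rfl, h⟩)

end IsMonomialIdeal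

variable {K : Type*} [Field K]

local notation "S" => MvPolynomial (Fin 4) K
local notation "m4" => (Ideal.span {(X 0 : MvPolynomial (Fin 4) K), X 1, X 2, X 3})

/-- If `I ⊆ K[x,y,z,w]` is a monomial ideal and `S/I` is
sequentially Cohen–Macaulay (expressed via the dimension filtration coming from
an irredundant primary decomposition), then `I` is a Stanley ideal:
`S/I = ⊕ᵢ uᵢ K[Zᵢ]` is a direct sum of `K`-vector spaces with `|Zᵢ| ≥ depth (S/I)`. -/
theorem stmt_1 (I : Ideal S) (hI : IsMonomialIdeal I)
    (Q : Ideal S → Ideal S)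
    (hQ : ∀ p ∈ associatedPrimes S (S ⧸ I), (Q p).IsPrimary ∧ (Q p).radical = p)
    (hdec : I = ⨅ p ∈ associatedPrimes S (S ⧸ I), Q p)
    (hirr : ∀ p ∈ associatedPrimes S (S ⧸ I),
      I ≠ ⨅ q ∈ associatedPrimes S (S ⧸ I) \ {p}, Q q)
    (D : ℕ → Ideal S) (hD0 : D 0 = I)
    (hD : ∀ i : ℕ, D (i + 1) =
      ⨅ p ∈ {p | p ∈ associatedPrimes S (S ⧸ I) ∧
        (i : WithBot ℕ∞) < ringKrullDim (S ⧸ p)}, Q p)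
    (hseqCM : ∀ i < 4, Submodule.map (D i).mkQ (D (i + 1)) ≠ ⊥ →
      IsCM S m4 ↥(Submodule.map (D i).mkQ (D (i + 1)))) :
    ∃ (r : ℕ) (u : Fin r → S) (Z : Fin r → Finset (Fin 4)),
      (∀ i, ∃ e : Fin 4 →₀ ℕ, u i = MvPolynomial.monomial e 1) ∧
      DirectSum.IsInternal (fun i : Fin r => Submodule.span K
        {c : S ⧸ I | ∃ v : Fin 4 →₀ ℕ, (∀ j, v j ≠ 0 → j ∈ Z i) ∧
          c = Ideal.Quotient.mk I (u i * MvPolynomial.monomial v 1)}) ∧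
      ∀ i, mDepth S m4 (S ⧸ I) ≤ ((Z i).card : ℕ∞) := by
  have hm : m4 = Ideal.span (X '' (Set.univ : Set (Fin 4))) := by
    congr 1
    ext f
    simp [Fin.exists_fin_succ, eq_comm]
  obtain ⟨d, hd, hA⟩ := hI.exists_mDepth_le
  obtain ⟨r, e, Z, hZ, h⟩ := hI.exists_isInternal hA
  refine ⟨r, fun i => monomial (e i) 1, Z, fun i => ⟨e i, rfl⟩, h, fun i => ?_⟩
  rw [hm]
  exact hd.trans (Nat.cast_le.2 (hZ i))
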